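/- There is no choice of nonempty words x, y, z over {A,B,C} with |x|, |y|, |z| ≤ 3 such that the word x y x z y z x y x is a factor of P^n(A) for some n. -/

import Mathlib

inductive T where
  | A | B | C
deriving DecidableEq, Repr

open T

def P : T → List T
  | A => [A,B,C,B,A,C,B,C,A,B,C,B,A]
  | B => [B,C,A,C,B,A,C,A,B,C,A,C,B]
  | C => [C,A,B,A,C,B,A,B,C,A,B,A,C]

def Pw (w : List T) : List T := w.flatMap P

def SqFree (w : List T) : Prop := ∀ x : List T, x ≠ [] → ¬ (x ++ x) <:+: w

def rot : T → T
  | A => B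
  | B => C
  | C => A

def rotw (w : List T) : List T := w.map rot

def refT : T → T
  | A => A
  | B => C
  | C => B

def reflw (w : List T) : List T := w.map refT

def OccursAt (w v : List T) (i : ℕ) : Prop := (v.drop i).take w.length = w

theorem length_P (a : T) : (P a).length = 13 := by cases a <;> rfl

theorem length_Pw (w : List T) : (Pw w).length = 13 * w.length := by
  induction w with
  | nil => rfl
  | cons a t ih =>
    simp only [Pw, List.flatMap_cons, List.length_append, List.length_cons, length_P] at ih ⊢
    omega

theorem Pw_append (u v : List T) : Pw (u ++ v) = Pw u ++ Pw v := List.flatMap_append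

/-- A factor of length at most 27 of `Pw w` meets at most three consecutive blocks. -/
theorem exists_short_infix_of_infix_Pw {v w : List T} (hv : v.length ≤ 27) (h : v <:+: Pw w) :
    ∃ u, u <:+: w ∧ u.length ≤ 3 ∧ v <:+: Pw u := by
  induction w with
  | nil => exact ⟨[], List.infix_rfl, by simp, h⟩
  | cons a t ih =>
    obtain ⟨s, r, hsr⟩ := h
    by_cases hs : 13 ≤ s.length
    · have hcons : Pw (a :: t) = P a ++ Pw t := rfl
      have hP : P a <+: s :=
        List.prefix_of_prefix_length_le (List.prefix_append _ (Pw t))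
          (hcons ▸ hsr ▸ ⟨v ++ r, by simp⟩) (by simpa [length_P] using hs)
      obtain ⟨s', rfl⟩ := hP
      have hv' : v <:+: Pw t := ⟨s', r, by
        rw [hcons] at hsr
        simpa using hsr⟩
      obtain ⟨u, hut, hu, hvu⟩ := ih hv'
      exact ⟨u, hut.trans (List.infix_cons List.infix_rfl), hu, hvu⟩
    · refine ⟨(a :: t).take 3, (List.take_prefix _ _).isInfix, by simp, ?_⟩
      have hsplit : Pw ((a :: t).take 3) ++ Pw ((a :: t).drop 3) = Pw (a :: t) := by
        rw [← Pw_append, List.take_append_drop]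
      have hsv : s ++ v <+: Pw (a :: t) := ⟨r, hsr⟩
      have hlen : (s ++ v).length ≤ (Pw ((a :: t).take 3)).length := by
        have h₁ := hsv.length_le
        rw [length_Pw] at h₁ ⊢
        simp only [List.length_append, List.length_take] at h₁ ⊢
        omega
      have hpre : s ++ v <+: Pw ((a :: t).take 3) :=
        List.prefix_of_prefix_length_le hsv ⟨_, hsplit⟩ hlen
      exact (List.suffix_append s v).isInfix.trans hpre.isInfix

theorem isChain_ne_P (a : T) : (P a).IsChain (· ≠ ·) := by cases a <;> decide

theorem head?_Pw (w : List T) : (Pw w).head? = w.head? := by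
  rcases w with _ | ⟨a, t⟩
  · rfl
  · cases a <;> rfl

theorem getLast?_P (a : T) : (P a).getLast? = some a := by cases a <;> rfl

theorem isChain_ne_Pw {w : List T} (h : w.IsChain (· ≠ ·)) : (Pw w).IsChain (· ≠ ·) := by
  induction w with
  | nil => exact List.isChain_nil
  | cons a t ih =>
    rw [List.isChain_cons] at h
    change (P a ++ Pw t).IsChain _
    rw [List.isChain_append]
    refine ⟨isChain_ne_P a, ih h.2, fun x hx y hy => ?_⟩
    rw [getLast?_P, Option.mem_some_iff] at hx
    rw [head?_Pw] at hy
    exact hx ▸ h.1 y hy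

theorem isChain_ne_iterate_Pw (n : ℕ) : (Pw^[n] [A]).IsChain (· ≠ ·) := by
  induction n with
  | zero => exact List.isChain_singleton A
  | succ n ih =>
    rw [Function.iterate_succ_apply']
    exact isChain_ne_Pw ih

/-- Whether the nonempty word `s` begins with `xyxzyzxyx`, where `x`, `y`, `z` are the factors of `s`
of lengths `p`, `q`, `r` (possibly truncated at the end of `s`) at their first occurrences. -/
def startsWithPattern (p q r : ℕ) (s : List T) : Bool :=
  let x := s.take p
  let y := (s.drop p).take q
  let z := (s.drop (p + q + p)).take r
  (x ++ (z ++ (y ++ (z ++ (x ++ (y ++ x)))))).isPrefixOf (s.drop (p + q)) && !s.isEmpty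

theorem startsWithPattern_append {x : List T} (hx : x ≠ []) (y z r : List T) :
    startsWithPattern x.length y.length z.length
      (x ++ y ++ x ++ z ++ y ++ z ++ x ++ y ++ x ++ r) = true := by
  have hz : (x ++ y ++ x ++ z ++ y ++ z ++ x ++ y ++ x ++ r).drop
      (x.length + y.length + x.length) = z ++ y ++ z ++ x ++ y ++ x ++ r := by
    simp only [← List.drop_drop, List.append_assoc, List.drop_left]
  have hxz : (x ++ y ++ x ++ z ++ y ++ z ++ x ++ y ++ x ++ r).drop (x.length + y.length) =
      x ++ z ++ y ++ z ++ x ++ y ++ x ++ r := by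
    simp only [← List.drop_drop, List.append_assoc, List.drop_left]
  simp only [startsWithPattern, hz, hxz]
  simp [List.append_assoc, hx]

def avoidsPattern (w : List T) : Bool :=
  w.tails.all fun s => [1, 2, 3].all fun p => [1, 2, 3].all fun q => [1, 2, 3].all fun r =>
    !startsWithPattern p q r s

theorem not_infix_of_avoidsPattern {x y z w : List T} (hw : avoidsPattern w = true)
    (hx : x ≠ []) (hy : y ≠ []) (hz : z ≠ [])
    (hx3 : x.length ≤ 3) (hy3 : y.length ≤ 3) (hz3 : z.length ≤ 3) :
    ¬ (x ++ y ++ x ++ z ++ y ++ z ++ x ++ y ++ x) <:+: w := by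
  rintro ⟨s, r, rfl⟩
  have mem_of_length {l : List T} (hl : l ≠ []) (hl3 : l.length ≤ 3) :
      l.length ∈ [1, 2, 3] := by
    have := List.length_pos_iff.2 hl
    simp only [List.mem_cons, List.not_mem_nil, or_false]
    omega
  simp only [avoidsPattern, List.all_eq_true] at hw
  have h := hw (x ++ y ++ x ++ z ++ y ++ z ++ x ++ y ++ x ++ r)
    ((List.mem_tails _ _).2 ⟨s, by simp only [List.append_assoc]⟩)
    _ (mem_of_length hx hx3) _ (mem_of_length hy hy3) _ (mem_of_length hz hz3)
  rw [startsWithPattern_append hx] at h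
  exact absurd h (by decide)

instance : Fintype T := ⟨{A, B, C}, fun a => by cases a <;> decide⟩

theorem avoidsPattern_Pw_triple :
    ∀ a b c : T, a ≠ b → b ≠ c → avoidsPattern (Pw [a, b, c]) = true := by
  decide +kernel

theorem exists_triple_of_isChain_ne {u : List T} (hu : u.IsChain (· ≠ ·)) (h3 : u.length ≤ 3) :
    ∃ a b c : T, a ≠ b ∧ b ≠ c ∧ u <+: [a, b, c] := by
  have exists_ne' : ∀ a : T, ∃ b, a ≠ b := by decide
  match u, hu, h3 with
  | [], _, _ => exact ⟨A, B, A, by decide, by decide, List.nil_prefix⟩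
  | [a], _, _ =>
    obtain ⟨b, hb⟩ := exists_ne' a
    exact ⟨a, b, a, hb, hb.symm, ⟨[b, a], rfl⟩⟩
  | [a, b], hu, _ =>
    obtain ⟨c, hc⟩ := exists_ne' b
    exact ⟨a, b, c, by simpa using hu, hc, ⟨[c], rfl⟩⟩
  | [a, b, c], hu, _ =>
    have hu' : a ≠ b ∧ b ≠ c := by simpa using hu
    exact ⟨a, b, c, hu'.1, hu'.2, List.prefix_rfl⟩

theorem stmt17 (x y z : List T)
    (hx : x ≠ []) (hy : y ≠ []) (hz : z ≠ [])
    (hx3 : x.length ≤ 3) (hy3 : y.length ≤ 3) (hz3 : z.length ≤ 3) :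
    ∀ n : ℕ, ¬ (x ++ y ++ x ++ z ++ y ++ z ++ x ++ y ++ x) <:+: Pw^[n] [A] := by
  intro n h
  rcases n with _ | n
  · have hlen := h.length_le
    have hxpos := List.length_pos_iff.2 hx
    simp only [Function.iterate_zero, id_eq, List.length_append, List.length_singleton] at hlen
    omega
  rw [Function.iterate_succ_apply'] at h
  obtain ⟨u, hu, hu3, hv⟩ := exists_short_infix_of_infix_Pw
    (by simp only [List.length_append]; omega) h
  obtain ⟨a, b, c, hab, hbc, t, ht⟩ :=
    exists_triple_of_isChain_ne ((isChain_ne_iterate_Pw n).infix hu) hu3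
  refine not_infix_of_avoidsPattern (avoidsPattern_Pw_triple a b c hab hbc)
    hx hy hz hx3 hy3 hz3 (hv.trans ?_)
  rw [← ht, Pw_append]
  exact (List.prefix_append _ _).isInfix
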